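/- arXiv:2509.16143 — 6 statements merged into one kernel-verified Lean document; each statement's English description precedes it below -/
import Mathlib

section
/- Let G be a finite simple graph, let s ≥ 2 and r ≥ 1 be integers, and let u, v be distinct vertices of G with N_G(u) = N_G(v). If S is an s-club of G satisfying the vertex r-triangle property, u ∈ S, and |S| > 1, then S ∪ {v} is also an s-club of G satisfying the vertex r-triangle property. -/
/-- A triangle of a simple graph: a set of three pairwise adjacent vertices. -/
def IsTriangle {V : Type*} (G : SimpleGraph V) (T : Finset V) : Prop :=
  T.card = 3 ∧ ∀ u ∈ T, ∀ v ∈ T, u ≠ v → G.Adj u v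

/-- `S` satisfies the vertex `r`-triangle property in `G`: every vertex of `S`
belongs to at least `r` triangles of the induced subgraph `G[S]` (equivalently,
triangles of `G` all of whose vertices lie in `S`). -/
def VertexTriangleProp {V : Type*} (G : SimpleGraph V) (S : Set V) (r : ℕ) : Prop :=
  ∀ u ∈ S, r ≤ {T : Finset V | IsTriangle G T ∧ ↑T ⊆ S ∧ u ∈ T}.ncard

/-- `S` is an `s`-club of `G`: any two vertices of `S` are joined by a path of
length at most `s` inside the induced subgraph `G[S]`. -/
def IsSClub {V : Type*} (G : SimpleGraph V) (s : ℕ) (S : Set V) : Prop :=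
  ∀ u v : S, ∃ p : (G.induce S).Walk u v, p.length ≤ s

theorem adj_swap_of_neighborSet_eq {V : Type*} [DecidableEq V] {G : SimpleGraph V} {u v : V}
    (hN : G.neighborSet u = G.neighborSet v) {a b : V} (h : G.Adj a b) :
    G.Adj (Equiv.swap u v a) (Equiv.swap u v b) := by
  have key : ∀ w, G.Adj u w ↔ G.Adj v w := fun w => Set.ext_iff.1 hN w
  have key' : ∀ w, G.Adj w u ↔ G.Adj w v := fun w => by
    rw [G.adj_comm w u, G.adj_comm w v, key]
  have huv : ¬ G.Adj u v := fun h => G.loopless.irrefl v ((key v).1 h)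
  have hvu : ¬ G.Adj v u := fun h => huv h.symm
  simp only [Equiv.swap_apply_def]
  split_ifs <;> subst_vars <;> simp_all

theorem IsTriangle.image {V : Type*} [DecidableEq V] {G : SimpleGraph V} {T : Finset V}
    (hT : IsTriangle G T) {f : V → V} (hf : Function.Injective f)
    (hadj : ∀ a b, G.Adj a b → G.Adj (f a) (f b)) : IsTriangle G (T.image f) := by
  refine ⟨by rw [Finset.card_image_of_injective _ hf, hT.1], fun x hx y hy hxy => ?_⟩
  obtain ⟨a, ha, rfl⟩ := Finset.mem_image.1 hx
  obtain ⟨b, hb, rfl⟩ := Finset.mem_image.1 hy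
  exact hadj _ _ (hT.2 a ha b hb fun h => hxy (congrArg f h))

theorem VertexTriangleProp.exists_adj {V : Type*} {G : SimpleGraph V} {S : Set V} {r : ℕ}
    (h : VertexTriangleProp G S r) (hr : 1 ≤ r) {u : V} (hu : u ∈ S) :
    ∃ w ∈ S, G.Adj u w := by
  obtain ⟨T, hT, hTS, huT⟩ := Set.nonempty_of_ncard_ne_zero
    (Nat.one_le_iff_ne_zero.1 (hr.trans (h u hu)))
  obtain ⟨w, hw, hwu⟩ := T.exists_mem_ne (by rw [hT.1]; norm_num) u
  exact ⟨w, hTS hw, hT.2 u huT w hw hwu.symm⟩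

theorem IsSClub.exists_walk_map {V : Type*} {G : SimpleGraph V} {s : ℕ} {S S' : Set V}
    (h : IsSClub G s S) {f : V → V} (hadj : ∀ a b, G.Adj a b → G.Adj (f a) (f b))
    (hf : Set.MapsTo f S S') {x y : V} (hx : x ∈ S) (hy : y ∈ S) {a b : S'}
    (ha : f x = a) (hb : f y = b) : ∃ p : (G.induce S').Walk a b, p.length ≤ s := by
  obtain rfl : ⟨f x, hf hx⟩ = a := Subtype.ext ha
  obtain rfl : ⟨f y, hf hy⟩ = b := Subtype.ext hb
  obtain ⟨p, hp⟩ := h ⟨x, hx⟩ ⟨y, hy⟩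
  let φ : G.induce S →g G.induce S' :=
    ⟨fun a => ⟨f a, hf a.2⟩, fun {a b} hab => hadj a b hab⟩
  exact ⟨p.map φ, by simpa using hp⟩

theorem mapsTo_swap_union_singleton {V : Type*} [DecidableEq V] {S : Set V} {u v : V}
    (hu : u ∈ S) : Set.MapsTo (Equiv.swap u v) S (S ∪ {v}) := by
  intro x hx
  rw [Equiv.swap_apply_def]
  split_ifs
  · exact Or.inr rfl
  · exact Or.inl hu
  · exact Or.inl hx

theorem IsSClub.union_singleton {V : Type*} [DecidableEq V] {G : SimpleGraph V} {s : ℕ}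
    {S : Set V} {u v w : V} (hS : IsSClub G s S) (hs : 2 ≤ s)
    (hN : G.neighborSet u = G.neighborSet v) (hu : u ∈ S) (hv : v ∉ S)
    (hw : w ∈ S) (huw : G.Adj u w) : IsSClub G s (S ∪ {v}) := by
  have hvw : G.Adj v w := (Set.ext_iff.1 hN w).1 huw
  have hvS : v ∈ S ∪ {v} := Or.inr rfl
  have from_v : ∀ y, ∀ hy : y ∈ S,
      ∃ p : (G.induce (S ∪ {v})).Walk ⟨v, hvS⟩ ⟨y, Or.inl hy⟩, p.length ≤ s := by
    intro y hy
    by_cases hyu : y = u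
    · subst hyu
      have h₁ : (G.induce (S ∪ {v})).Adj ⟨v, hvS⟩ ⟨w, Or.inl hw⟩ := hvw
      have h₂ : (G.induce (S ∪ {v})).Adj ⟨w, Or.inl hw⟩ ⟨y, Or.inl hy⟩ := huw.symm
      exact ⟨.cons h₁ (.cons h₂ .nil), hs⟩
    · have hyv : y ≠ v := fun h => hv (h ▸ hy)
      exact hS.exists_walk_map (fun _ _ => adj_swap_of_neighborSet_eq hN)
        (mapsTo_swap_union_singleton (v := v) hu) hu hy
        (Equiv.swap_apply_left u v) (Equiv.swap_apply_of_ne_of_ne hyu hyv)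
  rintro ⟨x, hx | rfl⟩ ⟨y, hy | rfl⟩
  · exact hS.exists_walk_map (f := id) (fun _ _ h => h) (fun _ => Or.inl) hx hy rfl rfl
  · obtain ⟨p, hp⟩ := from_v x hx
    exact ⟨p.reverse, by simpa using hp⟩
  · exact from_v y hy
  · exact ⟨.nil, Nat.zero_le s⟩

theorem VertexTriangleProp.union_singleton {V : Type*} [Finite V] [DecidableEq V]
    {G : SimpleGraph V} {S : Set V} {r : ℕ} {u v : V} (hS : VertexTriangleProp G S r)
    (hN : G.neighborSet u = G.neighborSet v) (hu : u ∈ S) :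
    VertexTriangleProp G (S ∪ {v}) r := by
  rintro x (hx | rfl)
  · exact (hS x hx).trans (Set.ncard_le_ncard
      (fun T hT => ⟨hT.1, hT.2.1.trans Set.subset_union_left, hT.2.2⟩) (Set.toFinite _))
  · refine (hS u hu).trans (Set.ncard_le_ncard_of_injOn (Finset.image (Equiv.swap u x)) ?_
      (Finset.image_injective (Equiv.swap u x).injective).injOn (Set.toFinite _))
    rintro T ⟨hT, hTS, huT⟩
    refine ⟨hT.image (Equiv.swap u x).injective fun _ _ => adj_swap_of_neighborSet_eq hN, ?_,
      Finset.mem_image.2 ⟨u, huT, Equiv.swap_apply_left u x⟩⟩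
    rw [Finset.coe_image]
    exact ((mapsTo_swap_union_singleton hu).mono_left hTS).image_subset

theorem stmt0 {V : Type*} [Fintype V] [DecidableEq V] (G : SimpleGraph V)
    (s r : ℕ) (hs : 2 ≤ s) (hr : 1 ≤ r) (u v : V) (huv : u ≠ v)
    (hN : G.neighborSet u = G.neighborSet v)
    (S : Set V) (hclub : IsSClub G s S) (htri : VertexTriangleProp G S r)
    (huS : u ∈ S) (hScard : 1 < S.ncard) :
    IsSClub G s (S ∪ {v}) ∧ VertexTriangleProp G (S ∪ {v}) r := by
  by_cases hv : v ∈ S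
  · rw [Set.union_eq_self_of_subset_right (Set.singleton_subset_iff.2 hv)]
    exact ⟨hclub, htri⟩
  · obtain ⟨w, hw, huw⟩ := htri.exists_adj hr huS
    exact ⟨hclub.union_singleton hs hN huS hv hw huw, htri.union_singleton hN huS⟩
end

section
/- Let G be a finite simple graph, let x be a vertex of G such that G − x is bipartite, let r ≥ 1, and let S be a nonempty set of vertices of G satisfying the vertex r-triangle property. Then x ∈ S and every vertex of S \ {x} is adjacent to x (i.e., S is contained in the closed neighborhood N_G[x]). -/
/-- If deleting `x` leaves a bipartite graph, then every triangle contains `x`. -/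
theorem IsTriangle.mem_of_colorable_compl {V : Type*} {G : SimpleGraph V} {x : V}
    (hbip : (G.induce ({x}ᶜ : Set V)).Colorable 2) {T : Finset V} (hT : IsTriangle G T) :
    x ∈ T := by
  classical
  by_contra hx
  obtain ⟨C⟩ := hbip
  have hne : ∀ v ∈ T, v ∈ ({x}ᶜ : Set V) := fun v hv hvx => hx (hvx ▸ hv)
  have hinj : Function.Injective fun v : T => C ⟨v, hne v v.2⟩ := by
    intro u v huv
    by_contra h
    have hadj : G.Adj u v := hT.2 u u.2 v v.2 fun h' => h (Subtype.ext h')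
    exact C.valid (v := ⟨u, hne u u.2⟩) (w := ⟨v, hne v v.2⟩) hadj huv
  have hcard := Fintype.card_le_of_injective _ hinj
  simp [hT.1] at hcard

theorem stmt2 {V : Type*} [Fintype V] [DecidableEq V] (G : SimpleGraph V) (x : V)
    (hbip : (G.induce ({x}ᶜ : Set V)).Colorable 2)
    (r : ℕ) (hr : 1 ≤ r) (S : Set V) (hS : S.Nonempty)
    (htri : VertexTriangleProp G S r) :
    x ∈ S ∧ ∀ y ∈ S, y ≠ x → G.Adj x y := by
  have key : ∀ u ∈ S, ∃ T : Finset V, IsTriangle G T ∧ ↑T ⊆ S ∧ u ∈ T := fun u hu =>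
    Set.nonempty_of_ncard_ne_zero (Nat.one_le_iff_ne_zero.mp (hr.trans (htri u hu)))
  constructor
  · obtain ⟨u, hu⟩ := hS
    obtain ⟨T, hT, hTS, -⟩ := key u hu
    exact hTS (hT.mem_of_colorable_compl hbip)
  · intro y hy hyx
    obtain ⟨T, hT, -, hyT⟩ := key y hy
    exact hT.2 x (hT.mem_of_colorable_compl hbip) y hyT hyx.symm
end

section
/- Let F be a feedback edge set of a finite simple graph G, and let v be a vertex of G that is not an endpoint of any edge of F. Then v belongs to at most |F| triangles of G. -/
theorem stmt7 {V : Type*} [Fintype V] [DecidableEq V] (G : SimpleGraph V)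
    (F : Set (Sym2 V)) (hFE : F ⊆ G.edgeSet)
    (hforest : (G.deleteEdges F).IsAcyclic)
    (v : V) (hv : ∀ e ∈ F, v ∉ e) :
    {T : Finset V | IsTriangle G T ∧ v ∈ T}.ncard ≤ F.ncard := by
  have hsub : {T : Finset V | IsTriangle G T ∧ v ∈ T} ⊆
      (fun e : Sym2 V => insert v e.toFinset) '' F := by
    rintro T ⟨⟨hcard, hadj⟩, hvT⟩
    have hcard' : (T.erase v).card = 2 := by
      rw [Finset.card_erase_of_mem hvT, hcard]
    obtain ⟨a, b, hab, hT⟩ := Finset.card_eq_two.mp hcard'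
    have ha : a ∈ T.erase v := by simp [hT]
    have hb : b ∈ T.erase v := by simp [hT]
    rw [Finset.mem_erase] at ha hb
    refine ⟨s(a, b), ?_, ?_⟩
    · by_contra habF
      refine hforest.cliqueFree le_rfl {v, a, b} (SimpleGraph.is3Clique_triple_iff.mpr ?_)
      simp only [SimpleGraph.deleteEdges_adj]
      exact ⟨⟨hadj v hvT a ha.2 ha.1.symm, fun h => hv _ h (Sym2.mem_mk_left v a)⟩,
        ⟨hadj v hvT b hb.2 hb.1.symm, fun h => hv _ h (Sym2.mem_mk_left v b)⟩,
        hadj a ha.2 b hb.2 hab, habF⟩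
    · change insert v (s(a, b)).toFinset = T
      rw [Sym2.toFinset_mk_eq, ← hT, Finset.insert_erase hvT]
  exact (Set.ncard_le_ncard hsub (Set.toFinite _)).trans (Set.ncard_image_le F.toFinite)
end

section
/- Let F be a feedback edge set of a finite simple graph G, let uv be an edge of F, and let w be a vertex that is not an endpoint of any edge of F. Then {u, v, w} is a triangle of G if and only if w is adjacent to both u and v; moreover, in this case every path from u to v in the graph G − F passes through w (the unique u–v path in the forest G − F is u, w, v). -/
theorem stmt9 {V : Type*} [Fintype V] [DecidableEq V] (G : SimpleGraph V)
    (F : Set (Sym2 V)) (hFE : F ⊆ G.edgeSet)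
    (hforest : (G.deleteEdges F).IsAcyclic)
    (u v w : V) (huv : s(u, v) ∈ F) (hw : ∀ e ∈ F, w ∉ e) :
    (IsTriangle G {u, v, w} ↔ G.Adj w u ∧ G.Adj w v) ∧
      (G.Adj w u → G.Adj w v →
        ∀ p : (G.deleteEdges F).Walk u v, p.IsPath → w ∈ p.support) := by
  have huvG : G.Adj u v := hFE huv
  have hwu : w ≠ u := fun h => hw _ huv (by simp [h])
  have hwv : w ≠ v := fun h => hw _ huv (by simp [h])
  refine ⟨⟨fun h => ⟨h.2 w (by simp) u (by simp) hwu, h.2 w (by simp) v (by simp) hwv⟩, ?_⟩, ?_⟩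
  · rintro ⟨hu, hv⟩
    refine ⟨Finset.card_eq_three.2 ⟨u, v, w, huvG.ne, hwu.symm, hwv.symm, rfl⟩, ?_⟩
    intro a ha b hb hab
    simp only [Finset.mem_insert, Finset.mem_singleton] at ha hb
    rcases ha with rfl | rfl | rfl <;> rcases hb with rfl | rfl | rfl <;>
      first | exact absurd rfl hab | assumption | (apply SimpleGraph.Adj.symm; assumption)
  · intro hu hv p hp
    have hu' : (G.deleteEdges F).Adj u w :=
      SimpleGraph.deleteEdges_adj.2 ⟨hu.symm, fun h => hw _ h (by simp)⟩
    have hv' : (G.deleteEdges F).Adj w v :=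
      SimpleGraph.deleteEdges_adj.2 ⟨hv, fun h => hw _ h (by simp)⟩
    have hq : (SimpleGraph.Walk.cons hu' (SimpleGraph.Walk.cons hv' .nil)).IsPath := by
      simp [SimpleGraph.Walk.cons_isPath_iff, hwu.symm, hwv, huvG.ne]
    have hpq := congrArg Subtype.val ((hforest.subsingleton_path u v).elim ⟨p, hp⟩ ⟨_, hq⟩)
    simp only at hpq
    simp [hpq]
end

section
/- Let F be a feedback edge set of a finite simple graph G. Then the number of vertices of G that are not endpoints of any edge of F and that belong to at least one triangle of G is at most |F|. -/
/-- In an acyclic graph, two distinct vertices have at most one common neighbour. -/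
theorem SimpleGraph.IsAcyclic.eq_of_common_neighbors {V : Type*} {H : SimpleGraph V}
    (hH : H.IsAcyclic) {a b w w' : V} (hab : a ≠ b) (haw : H.Adj a w) (hwb : H.Adj w b)
    (haw' : H.Adj a w') (hwb' : H.Adj w' b) : w = w' := by
  have hp : (SimpleGraph.Walk.cons haw (.cons hwb .nil)).IsPath := by
    simp [SimpleGraph.Walk.cons_isPath_iff, hwb.ne, haw.ne, hab]
  have hp' : (SimpleGraph.Walk.cons haw' (.cons hwb' .nil)).IsPath := by
    simp [SimpleGraph.Walk.cons_isPath_iff, hwb'.ne, haw'.ne, hab]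
  have h := congrArg (fun p : H.Path a b => p.1.support)
    ((hH.subsingleton_path a b).elim ⟨_, hp⟩ ⟨_, hp'⟩)
  simpa using h

/-- In an acyclic graph, two vertices with a common neighbour are not adjacent. -/
theorem SimpleGraph.IsAcyclic.not_adj_of_common_neighbor {V : Type*} {H : SimpleGraph V}
    (hH : H.IsAcyclic) {a b w : V} (haw : H.Adj a w) (hwb : H.Adj w b) : ¬ H.Adj a b := by
  intro hab
  have hp : (SimpleGraph.Walk.cons haw (.cons hwb .nil)).IsPath := by
    simp [SimpleGraph.Walk.cons_isPath_iff, hwb.ne, haw.ne, hab.ne]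
  have hp' : (SimpleGraph.Walk.cons hab SimpleGraph.Walk.nil).IsPath := by
    simp [SimpleGraph.Walk.cons_isPath_iff, hab.ne]
  have h := congrArg (fun p : H.Path a b => p.1.length)
    ((hH.subsingleton_path a b).elim ⟨_, hp⟩ ⟨_, hp'⟩)
  simp at h

/-- A vertex of a triangle is adjacent to the two others, which are adjacent to each other. -/
theorem IsTriangle.exists_adj {V : Type*} [DecidableEq V] {G : SimpleGraph V} {T : Finset V}
    (hT : IsTriangle G T) {w : V} (hw : w ∈ T) :
    ∃ a b, G.Adj a b ∧ G.Adj a w ∧ G.Adj w b := by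
  obtain ⟨hcard, hadj⟩ := hT
  have herase : (T.erase w).card = 2 := by
    rw [Finset.card_erase_of_mem hw, hcard]
  obtain ⟨a, b, hab, he⟩ := Finset.card_eq_two.mp herase
  have ha : a ∈ T.erase w := by simp [he]
  have hb : b ∈ T.erase w := by simp [he]
  rw [Finset.mem_erase] at ha hb
  exact ⟨a, b, hadj a ha.2 b hb.2 hab, hadj a ha.2 w hw ha.1, hadj w hw b hb.2 hb.1.symm⟩

theorem stmt11 {V : Type*} [Fintype V] [DecidableEq V] (G : SimpleGraph V)
    (F : Set (Sym2 V)) (hFE : F ⊆ G.edgeSet)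
    (hforest : (G.deleteEdges F).IsAcyclic) :
    {w : V | (∀ e ∈ F, w ∉ e) ∧ ∃ T : Finset V, IsTriangle G T ∧ w ∈ T}.ncard
      ≤ F.ncard := by
  have key : ∀ w ∈ {w : V | (∀ e ∈ F, w ∉ e) ∧ ∃ T : Finset V, IsTriangle G T ∧ w ∈ T},
      ∃ e ∈ F, ∀ x ∈ e, (G.deleteEdges F).Adj x w := by
    rintro w ⟨hw, T, hT, hwT⟩
    obtain ⟨a, b, hab, haw, hwb⟩ := hT.exists_adj hwT
    have hdel : ∀ x, G.Adj x w → (G.deleteEdges F).Adj x w := fun x hx =>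
      SimpleGraph.deleteEdges_adj.mpr ⟨hx, fun h => hw _ h (Sym2.mem_mk_right x w)⟩
    refine ⟨s(a, b), ?_, ?_⟩
    · by_contra hF
      exact hforest.not_adj_of_common_neighbor (hdel a haw) (hdel b hwb.symm).symm
        (SimpleGraph.deleteEdges_adj.mpr ⟨hab, hF⟩)
    · intro x hx
      rcases Sym2.mem_iff.mp hx with rfl | rfl
      · exact hdel _ haw
      · exact hdel _ hwb.symm
  obtain hV | ⟨⟨v⟩⟩ := isEmpty_or_nonempty V
  · simp [Set.eq_empty_of_isEmpty]
  have : Nonempty (Sym2 V) := ⟨s(v, v)⟩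
  choose! f hfF hf using key
  refine Set.ncard_le_ncard_of_injOn f hfF ?_ (Set.toFinite F)
  intro w hw w' hw' heq
  have hedge := hFE (hfF w hw)
  have h := hf w hw
  have h' := hf w' hw'
  rw [← heq] at h'
  generalize f w = e at hedge h h'
  induction e with
  | h a b =>
    exact hforest.eq_of_common_neighbors (SimpleGraph.mem_edgeSet G |>.mp hedge).ne
      (h a (by simp)) (h b (by simp)).symm (h' a (by simp)) (h' b (by simp)).symm
end

section
/- Let F be a feedback edge set of a finite simple graph G, let W denote the set of vertices of G that belong to at least one triangle of G, and let T = V(F) ∪ W. Then |T| ≤ 3·|F|, and if F is nonempty then the induced subgraph G[T] has at most 4·|F| − 1 edges. -/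
/-- In an acyclic graph, two distinct vertices have at most one common neighbor. -/
theorem SimpleGraph.IsAcyclic.common_neighbor_unique {V : Type*} {H : SimpleGraph V}
    (hH : H.IsAcyclic) {a b v w : V} (hab : a ≠ b) (hav : H.Adj a v) (hvb : H.Adj v b)
    (haw : H.Adj a w) (hwb : H.Adj w b) : v = w := by
  have isPath : ∀ {x : V} (h₁ : H.Adj a x) (h₂ : H.Adj x b),
      (SimpleGraph.Walk.cons h₁ (SimpleGraph.Walk.cons h₂ .nil)).IsPath := by
    intro x h₁ h₂
    simp [SimpleGraph.Walk.cons_isPath_iff, h₁.ne, h₂.ne, hab]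
  have h := (hH.subsingleton_path a b).elim ⟨_, isPath hav hvb⟩ ⟨_, isPath haw hwb⟩
  have h' := congrArg (fun p => p.1.support) h
  simpa using h'

/-- An acyclic graph on a nonempty finite vertex type has fewer edges than vertices. -/
theorem SimpleGraph.IsAcyclic.ncard_edgeSet_lt {V : Type*} [Finite V] [Nonempty V]
    {H : SimpleGraph V} (hH : H.IsAcyclic) : H.edgeSet.ncard < Nat.card V := by
  classical
  have := Fintype.ofFinite V
  obtain ⟨T, hHT, -, hT⟩ := SimpleGraph.connected_top.exists_isTree_le_of_le_of_isAcyclic le_top hH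
  have h₁ : H.edgeSet.ncard ≤ T.edgeSet.ncard :=
    Set.ncard_le_ncard (SimpleGraph.edgeSet_mono hHT) (Set.toFinite _)
  have h₂ := hT.card_edgeFinset
  rw [← SimpleGraph.coe_edgeFinset T, Set.ncard_coe_finset] at h₁
  rw [Nat.card_eq_fintype_card]
  omega

/-- A nonempty finite vertex set of an acyclic graph spans fewer edges than it has vertices. -/
theorem SimpleGraph.IsAcyclic.ncard_edges_within_lt {V : Type*} [Finite V]
    {H : SimpleGraph V} (hH : H.IsAcyclic) {S : Set V} (hS : S.Nonempty) :
    {e ∈ H.edgeSet | ∀ x ∈ e, x ∈ S}.ncard < S.ncard := by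
  have := hS.to_subtype
  have hsub : {e ∈ H.edgeSet | ∀ x ∈ e, x ∈ S} ⊆
      Sym2.map Subtype.val '' (H.induce S).edgeSet := by
    rintro ⟨a, b⟩ ⟨hab, hx⟩
    exact ⟨s(⟨a, hx a (Sym2.mem_mk_left a b)⟩, ⟨b, hx b (Sym2.mem_mk_right a b)⟩), hab, rfl⟩
  calc _ ≤ _ := Set.ncard_le_ncard hsub (Set.toFinite _)
    _ ≤ (H.induce S).edgeSet.ncard := Set.ncard_image_le (Set.toFinite _)
    _ < Nat.card S := (hH.induce S).ncard_edgeSet_lt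
    _ = S.ncard := Nat.card_coe_set_eq S

/-- A finite set of edges has at most twice as many endpoints as edges. -/
theorem Sym2.ncard_endpoints_le {V : Type*} [Finite V] (F : Set (Sym2 V)) :
    {x : V | ∃ e ∈ F, x ∈ e}.ncard ≤ 2 * F.ncard := by
  classical
  have hF := F.toFinite
  have heq : {x : V | ∃ e ∈ F, x ∈ e} = ↑(hF.toFinset.biUnion Sym2.toFinset) := by
    ext x; simp
  rw [heq, Set.ncard_coe_finset, Set.ncard_eq_toFinset_card F hF, mul_comm]
  refine Finset.card_biUnion_le_card_mul _ _ _ fun e _ => ?_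
  rw [Sym2.card_toFinset]
  split_ifs <;> omega

/-- A vertex on a triangle that is no endpoint of a feedback edge set `F` is opposite, in that
triangle, to an edge of `F`. -/
theorem IsTriangle.exists_opposite_edge {V : Type*} {G : SimpleGraph V} {F : Set (Sym2 V)}
    (hforest : (G.deleteEdges F).IsAcyclic) {T : Finset V} (hT : IsTriangle G T) {w : V}
    (hw : w ∈ T) (hwF : ¬ ∃ e ∈ F, w ∈ e) :
    ∃ a b, a ≠ b ∧ s(a, b) ∈ F ∧ (G.deleteEdges F).Adj a w ∧ (G.deleteEdges F).Adj w b := by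
  classical
  obtain ⟨hcard, hadj⟩ := hT
  have hcard' : (T.erase w).card = 2 := by rw [Finset.card_erase_of_mem hw, hcard]
  obtain ⟨a, b, hab, hTab⟩ := Finset.card_eq_two.mp hcard'
  have ha : a ∈ T.erase w := by simp [hTab]
  have hb : b ∈ T.erase w := by simp [hTab]
  rw [Finset.mem_erase] at ha hb
  have haw : (G.deleteEdges F).Adj a w := SimpleGraph.deleteEdges_adj.mpr
    ⟨hadj a ha.2 w hw ha.1, fun h => hwF ⟨_, h, Sym2.mem_mk_right a w⟩⟩
  have hwb : (G.deleteEdges F).Adj w b := SimpleGraph.deleteEdges_adj.mpr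
    ⟨hadj w hw b hb.2 hb.1.symm, fun h => hwF ⟨_, h, Sym2.mem_mk_left w b⟩⟩
  refine ⟨a, b, hab, ?_, haw, hwb⟩
  by_contra hF
  have hadjab : (G.deleteEdges F).Adj a b :=
    SimpleGraph.deleteEdges_adj.mpr ⟨hadj a ha.2 b hb.2 hab, hF⟩
  exact hforest.cliqueFree le_rfl _
    (SimpleGraph.is3Clique_triple_iff.mpr ⟨haw, hadjab, hwb⟩)

theorem stmt12 {V : Type*} [Fintype V] [DecidableEq V] (G : SimpleGraph V)
    (F : Set (Sym2 V)) (hFE : F ⊆ G.edgeSet)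
    (hforest : (G.deleteEdges F).IsAcyclic)
    (W : Set V) (hW : W = {w : V | ∃ T : Finset V, IsTriangle G T ∧ w ∈ T})
    (Tset : Set V) (hT : Tset = {x : V | ∃ e ∈ F, x ∈ e} ∪ W) :
    Tset.ncard ≤ 3 * F.ncard ∧
      (F.Nonempty →
        {e ∈ G.edgeSet | ∀ x ∈ e, x ∈ Tset}.ncard ≤ 4 * F.ncard - 1) := by
  have hopp : ∀ w ∈ W \ {x : V | ∃ e ∈ F, x ∈ e}, ∃ e ∈ F, ∃ a b, e = s(a, b) ∧ a ≠ b ∧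
      (G.deleteEdges F).Adj a w ∧ (G.deleteEdges F).Adj w b := by
    rintro w ⟨hwW, hwF⟩
    rw [hW] at hwW
    obtain ⟨T, hTri, hwT⟩ := hwW
    obtain ⟨a, b, hab, hF, haw, hwb⟩ := hTri.exists_opposite_edge hforest hwT hwF
    exact ⟨_, hF, a, b, rfl, hab, haw, hwb⟩
  have hW_le : (W \ {x : V | ∃ e ∈ F, x ∈ e}).ncard ≤ F.ncard := by
    rcases isEmpty_or_nonempty V with hV | ⟨⟨x⟩⟩
    · simp [Set.eq_empty_of_isEmpty]
    have : Nonempty (Sym2 V) := ⟨s(x, x)⟩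
    choose! f hfF hf using hopp
    refine Set.ncard_le_ncard_of_injOn f hfF ?_ (Set.toFinite _)
    intro v hv w hw hvw
    obtain ⟨a, b, he, hab, hav, hvb⟩ := hf v hv
    obtain ⟨c, d, he', -, hcw, hwd⟩ := hf w hw
    rw [hvw, he', Sym2.eq_iff] at he
    rcases he with ⟨rfl, rfl⟩ | ⟨rfl, rfl⟩
    · exact hforest.common_neighbor_unique hab hav hvb hcw hwd
    · exact hforest.common_neighbor_unique hab hav hvb hwd.symm hcw.symm
  have hT_le : Tset.ncard ≤ 3 * F.ncard := by
    rw [hT, ← Set.union_sdiff_self]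
    have h₁ := Set.ncard_union_le {x : V | ∃ e ∈ F, x ∈ e} (W \ {x : V | ∃ e ∈ F, x ∈ e})
    have h₂ := Sym2.ncard_endpoints_le F
    omega
  refine ⟨hT_le, fun hFne => ?_⟩
  have hTne : Tset.Nonempty := by
    obtain ⟨⟨a, b⟩, he⟩ := hFne
    exact ⟨a, hT ▸ Or.inl ⟨_, he, Sym2.mem_mk_left a b⟩⟩
  have hsub : {e ∈ G.edgeSet | ∀ x ∈ e, x ∈ Tset} ⊆
      F ∪ {e ∈ (G.deleteEdges F).edgeSet | ∀ x ∈ e, x ∈ Tset} := by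
    rintro e ⟨heG, heT⟩
    by_cases heF : e ∈ F
    · exact Or.inl heF
    · exact Or.inr ⟨by rw [SimpleGraph.edgeSet_deleteEdges]; exact ⟨heG, heF⟩, heT⟩
  have h₁ := Set.ncard_le_ncard hsub (Set.toFinite _)
  have h₂ := Set.ncard_union_le F {e ∈ (G.deleteEdges F).edgeSet | ∀ x ∈ e, x ∈ Tset}
  have h₃ := hforest.ncard_edges_within_lt hTne
  omega
end
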